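/- arXiv:1906.04098 — 5 statements merged into one kernel-verified Lean document; each statement's English description precedes it below -/
import Mathlib

section
/- Let β > 0, m > 0 and x ∈ ℝ³. For every z ∈ ℂ with -β < Im z < 0, the function p ↦ e^{i⟨p,x⟩} · (1/(2w(p))) · ( e^{-i w(p) z}/(1 - e^{-β w(p)}) + e^{i w(p) z}/(e^{β w(p)} - 1) ) is Lebesgue integrable on ℝ³. -/
open MeasureTheory

open Module in
/-- The function `v ↦ exp (-c ‖v‖)` is integrable on a finite-dimensional normed space. -/
theorem integrable_exp_neg_mul_norm {E : Type*} [NormedAddCommGroup E] [NormedSpace ℝ E]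
    [FiniteDimensional ℝ E] [MeasurableSpace E] [BorelSpace E] (μ : Measure E)
    [μ.IsAddHaarMeasure] {c : ℝ} (hc : 0 < c) :
    Integrable (fun v : E => Real.exp (-(c * ‖v‖))) μ := by
  set n : ℕ := finrank ℝ E + 1 with hn
  have hnr : (finrank ℝ E : ℝ) < (n : ℝ) := by rw [hn]; push_cast; linarith
  refine ((integrable_one_add_norm (μ := μ) hnr).const_mul
    (n.factorial * Real.exp c / c ^ n)).mono' (by fun_prop) (.of_forall fun v => ?_)
  have hv : 0 < 1 + ‖v‖ := by positivity
  have h := Real.pow_div_factorial_le_exp (c * (1 + ‖v‖)) (by positivity) n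
  rw [mul_pow, div_le_iff₀ (by positivity), mul_add, mul_one, Real.exp_add] at h
  rw [Real.norm_of_nonneg (Real.exp_pos _).le, Real.rpow_neg hv.le, Real.rpow_natCast,
    Real.exp_neg, ← div_eq_mul_inv, div_div, inv_eq_one_div,
    div_le_div_iff₀ (by positivity) (by positivity)]
  linarith

/-- Bound on the Bose–Einstein weighted frequency factors at frequency `w ≥ m`. -/
theorem norm_thermal_factor_le {β m w : ℝ} (hβ : 0 < β) (hm : 0 < m) (hw : m ≤ w) (z : ℂ) :
    ‖Complex.exp (-Complex.I * (w : ℂ) * z) / (1 - Complex.exp (-(β : ℂ) * (w : ℂ))) +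
        Complex.exp (Complex.I * (w : ℂ) * z) / (Complex.exp ((β : ℂ) * (w : ℂ)) - 1)‖ ≤
      (Real.exp (-(-z.im * w)) + Real.exp (-((β + z.im) * w))) / (1 - Real.exp (-(β * m))) := by
  have hm' : 0 < 1 - Real.exp (-(β * m)) := by
    rw [sub_pos, Real.exp_lt_one_iff]; nlinarith
  have hmw : 1 - Real.exp (-(β * m)) ≤ 1 - Real.exp (-(β * w)) := by gcongr
  have hw' := hm'.trans_le hmw
  have hd₁ : 1 - Complex.exp (-(β : ℂ) * (w : ℂ)) = ((1 - Real.exp (-(β * w)) : ℝ) : ℂ) := by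
    push_cast; rw [neg_mul]
  have hd₂ : Complex.exp ((β : ℂ) * (w : ℂ)) - 1 =
      ((Real.exp (β * w) * (1 - Real.exp (-(β * w))) : ℝ) : ℂ) := by
    rw [mul_sub, ← Real.exp_add, add_neg_cancel, Real.exp_zero]; push_cast; ring
  rw [add_div]
  refine (norm_add_le _ _).trans (add_le_add ?_ ?_)
  · rw [hd₁, norm_div, Complex.norm_exp, Complex.norm_of_nonneg hw'.le,
      show (-Complex.I * (w : ℂ) * z).re = -(-z.im * w) by simp; ring]
    gcongr
  · rw [hd₂, norm_div, Complex.norm_exp, Complex.norm_of_nonneg (by positivity), ← div_div,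
      ← Real.exp_sub, show (Complex.I * (w : ℂ) * z).re - β * w = -((β + z.im) * w) by simp; ring]
    gcongr

/-- For `β > 0`, `m > 0`, `x ∈ ℝ³` and `z ∈ ℂ` with `-β < Im z < 0`,
the integrand of the analytic continuation of the thermal two-point function is
Lebesgue integrable on `ℝ³`. -/
theorem thermal_two_point_integrand_integrable (β m : ℝ) (hβ : 0 < β) (hm : 0 < m)
    (x : EuclideanSpace ℝ (Fin 3)) (z : ℂ) (h1 : -β < z.im) (h2 : z.im < 0) :
    Integrable (fun p : EuclideanSpace ℝ (Fin 3) =>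
      Complex.exp (Complex.I * ((inner ℝ p x : ℝ) : ℂ)) *
        (1 / (2 * (Real.sqrt (‖p‖ ^ 2 + m ^ 2) : ℂ))) *
        (Complex.exp (-Complex.I * (Real.sqrt (‖p‖ ^ 2 + m ^ 2) : ℂ) * z) /
            (1 - Complex.exp (-(β : ℂ) * (Real.sqrt (‖p‖ ^ 2 + m ^ 2) : ℂ))) +
          Complex.exp (Complex.I * (Real.sqrt (‖p‖ ^ 2 + m ^ 2) : ℂ) * z) /
            (Complex.exp ((β : ℂ) * (Real.sqrt (‖p‖ ^ 2 + m ^ 2) : ℂ)) - 1))) := by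
  have h₁ : 0 < -z.im := by linarith
  have h₂ : 0 < β + z.im := by linarith
  refine (((integrable_exp_neg_mul_norm volume h₁).add
    (integrable_exp_neg_mul_norm volume h₂)).const_mul
    (1 / (2 * m) / (1 - Real.exp (-(β * m))))).mono'
    (Measurable.aestronglyMeasurable (by fun_prop)) (.of_forall fun p => ?_)
  set w := Real.sqrt (‖p‖ ^ 2 + m ^ 2)
  have hmw : m ≤ w := Real.le_sqrt_of_sq_le (by linarith [sq_nonneg ‖p‖])
  have hpw : ‖p‖ ≤ w := Real.le_sqrt_of_sq_le (by linarith [sq_nonneg m])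
  have hw : 0 < w := hm.trans_le hmw
  have hden : 0 < 1 - Real.exp (-(β * m)) := by
    rw [sub_pos, Real.exp_lt_one_iff]; nlinarith
  have hphase : ‖Complex.exp (Complex.I * ((inner ℝ p x : ℝ) : ℂ))‖ = 1 := by
    rw [mul_comm, Complex.norm_exp_ofReal_mul_I]
  have hpre : ‖(1 / (2 * (w : ℂ)))‖ = 1 / (2 * w) := by
    simp [abs_of_pos hw]
  rw [norm_mul, norm_mul, hphase, one_mul, hpre]
  calc _ ≤ 1 / (2 * m) * ((Real.exp (-(-z.im * ‖p‖)) + Real.exp (-((β + z.im) * ‖p‖))) /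
        (1 - Real.exp (-(β * m)))) := by
        refine mul_le_mul (by gcongr) ((norm_thermal_factor_le hβ hm hmw z).trans ?_)
          (norm_nonneg _) (by positivity)
        gcongr
    _ = _ := by simp only [Pi.add_apply]; ring
end

section
/- Let β > 0, m > 0 and x ∈ ℝ³, and for z ∈ ℂ with -β < Im z < 0 define G(z) = ∫_{ℝ³} e^{i⟨p,x⟩} · (1/(2w(p))) · ( e^{-i w(p) z}/(1 - e^{-β w(p)}) + e^{i w(p) z}/(e^{β w(p)} - 1) ) dp. Then for every z with -β < Im z < 0 one has G(z) = G(-z - iβ) (note that -z - iβ also lies in the strip). This expresses simultaneously the reflection symmetry and the iβ-periodicity (KMS property) of the thermal propagator. -/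
open MeasureTheory

/-- The analytic continuation `Δ^β_+(z, x)` (up to `(2π)^{-3}`) of the thermal two-point
function of the free KMS state at inverse temperature `β` to complex times `z`. -/
noncomputable def thermalG (β m : ℝ) (x : EuclideanSpace ℝ (Fin 3)) (z : ℂ) : ℂ :=
  ∫ p : EuclideanSpace ℝ (Fin 3),
    Complex.exp (Complex.I * ((inner ℝ p x : ℝ) : ℂ)) *
      (1 / (2 * (Real.sqrt (‖p‖ ^ 2 + m ^ 2) : ℂ))) *
      (Complex.exp (-Complex.I * (Real.sqrt (‖p‖ ^ 2 + m ^ 2) : ℂ) * z) /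
          (1 - Complex.exp (-(β : ℂ) * (Real.sqrt (‖p‖ ^ 2 + m ^ 2) : ℂ))) +
        Complex.exp (Complex.I * (Real.sqrt (‖p‖ ^ 2 + m ^ 2) : ℂ) * z) /
          (Complex.exp ((β : ℂ) * (Real.sqrt (‖p‖ ^ 2 + m ^ 2) : ℂ)) - 1))

/-- The thermal weight of a mode of frequency `w` is invariant under `z ↦ -z - iβ`. -/
theorem thermal_weight_reflection (b w z : ℂ) :
    Complex.exp (-Complex.I * w * z) / (1 - Complex.exp (-b * w)) +
        Complex.exp (Complex.I * w * z) / (Complex.exp (b * w) - 1) =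
      Complex.exp (-Complex.I * w * (-z - Complex.I * b)) / (1 - Complex.exp (-b * w)) +
        Complex.exp (Complex.I * w * (-z - Complex.I * b)) / (Complex.exp (b * w) - 1) := by
  have hneg : Complex.exp (-Complex.I * w * (-z - Complex.I * b)) =
      Complex.exp (Complex.I * w * z) * Complex.exp (-b * w) := by
    rw [← Complex.exp_add]
    congr 1
    linear_combination b * w * Complex.I_sq
  have hpos : Complex.exp (Complex.I * w * (-z - Complex.I * b)) =
      Complex.exp (-Complex.I * w * z) * Complex.exp (b * w) := by
    rw [← Complex.exp_add]
    congr 1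
    linear_combination -b * w * Complex.I_sq
  have hinv : Complex.exp (-b * w) = (Complex.exp (b * w))⁻¹ := by
    rw [neg_mul, Complex.exp_neg]
  rw [hneg, hpos, hinv]
  have hne := Complex.exp_ne_zero (b * w)
  generalize Complex.exp (b * w) = E at hne ⊢
  have hden : 1 - E⁻¹ = (E - 1) / E := by field_simp
  rw [hden, div_div_eq_mul_div, div_div_eq_mul_div, inv_mul_cancel_right₀ hne,
    add_comm]

/-- reflection symmetry combined with the `iβ`-periodicity (KMS property) of
the thermal propagator: `G(z) = G(-z - iβ)` for `z` in the strip `-β < Im z < 0`. -/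
theorem thermalG_reflection_KMS (β m : ℝ) (hβ : 0 < β) (hm : 0 < m)
    (x : EuclideanSpace ℝ (Fin 3)) (z : ℂ) (h1 : -β < z.im) (h2 : z.im < 0) :
    thermalG β m x z = thermalG β m x (-z - Complex.I * (β : ℂ)) := by
  unfold thermalG
  congr 1
  funext p
  rw [thermal_weight_reflection]
end

section
/- Let β > 0, m > 0, δt ∈ ℝ, let g : ℝ → ℂ be bounded and measurable, and let f : ℝ³ → ℂ be integrable. For t ∈ ℝ and p ∈ ℝ³ define B(t,p) = -(2/(2π)³) · ( b₊(w(p))² / (4 w(p)²) ) · [ ( g(2w(p)) e^{-2 i w(p) t} + g(-2w(p)) e^{2 i w(p) t} ) · (1 - e^{-2β w(p)})/(2 w(p)) + β e^{-β w(p)} e^{-2 i w(p) δt} ]. Then lim_{t→+∞} ∫_{ℝ³} B(t,p) f(p) dp = -(2/(2π)³) ∫_{ℝ³} ( b₊(w(p))² / (4 w(p)²) ) β e^{-β w(p)} e^{-2 i w(p) δt} f(p) dp. -/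
open MeasureTheory Filter

/-- `w(p) = √(|p|² + m²)`. -/
noncomputable def wfun (m : ℝ) (p : EuclideanSpace ℝ (Fin 3)) : ℝ :=
  Real.sqrt (‖p‖ ^ 2 + m ^ 2)

/-- Bose factor `b₊(x) = (1 - e^{-βx})⁻¹`. -/
noncomputable def bplus (β x : ℝ) : ℝ := (1 - Real.exp (-β * x))⁻¹

/-- The first-order correction `B̂^{[1]}(t, δt, p)` coming from `U(iβ)` for a quadratic
interaction, with `g` the Fourier transform of the time derivative of the switching
function. -/
noncomputable def Bhat (β m δt : ℝ) (g : ℝ → ℂ) (t : ℝ)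
    (p : EuclideanSpace ℝ (Fin 3)) : ℂ :=
  ((-(2 / (2 * Real.pi) ^ 3) : ℝ) : ℂ) *
    ((bplus β (wfun m p) ^ 2 / (4 * wfun m p ^ 2) : ℝ) : ℂ) *
    ((g (2 * wfun m p) * Complex.exp (-2 * Complex.I * (wfun m p : ℂ) * (t : ℂ)) +
        g (-(2 * wfun m p)) * Complex.exp (2 * Complex.I * (wfun m p : ℂ) * (t : ℂ))) *
        (((1 - Real.exp (-2 * β * wfun m p)) / (2 * wfun m p) : ℝ) : ℂ) +
      ((β * Real.exp (-β * wfun m p) : ℝ) : ℂ) *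
        Complex.exp (-2 * Complex.I * (wfun m p : ℂ) * (δt : ℂ)))

/-- Riemann–Lebesgue lemma for a finite measure that is absolutely continuous with respect to
Lebesgue measure. -/
lemma tendsto_integral_exp_of_absolutelyContinuous (ν : Measure ℝ) [IsFiniteMeasure ν]
    (hν : ν ≪ volume) :
    Tendsto (fun t : ℝ => ∫ v : ℝ, Complex.exp (-2 * Complex.I * (v : ℂ) * (t : ℂ)) ∂ν)
      (cocompact ℝ) (nhds 0) := by
  have h := (Real.tendsto_integral_exp_smul_cocompact
    (fun v => ((ν.rnDeriv volume v).toReal : ℂ))).comp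
      (Homeomorph.mulRight₀ _ (inv_ne_zero Real.pi_ne_zero)).isClosedEmbedding.tendsto_cocompact
  refine h.congr fun t => ?_
  rw [← integral_rnDeriv_smul hν]
  refine integral_congr_ae (.of_forall fun v => ?_)
  have hpi : (Real.pi : ℂ) ≠ 0 := Complex.ofReal_ne_zero.2 Real.pi_ne_zero
  have h_exp : ((2 * Real.pi * -(v * (t * Real.pi⁻¹)) : ℝ) : ℂ) * Complex.I =
      -2 * Complex.I * (v : ℂ) * (t : ℂ) := by
    push_cast
    field_simp
  simp only [Homeomorph.coe_mulRight₀, Circle.smul_def, Real.fourierChar_apply, h_exp,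
    smul_eq_mul, Complex.real_smul]
  exact mul_comm _ _

section PhaseFunction

variable {α : Type*} [MeasurableSpace α] {μ : Measure α} {W : α → ℝ}

lemma integrable_exp_comp_mul (hW : Measurable W) {F : α → ℂ} (hF : Integrable F μ)
    (s : ℝ) : Integrable (fun a => Complex.exp (-2 * Complex.I * (W a : ℂ) * (s : ℂ)) * F a) μ := by
  refine Integrable.bdd_mul (c := 1) hF ?_ (.of_forall fun a => by simp [Complex.norm_exp])
  have : Continuous fun x : ℝ => Complex.exp (-2 * Complex.I * (x : ℂ) * (s : ℂ)) := by fun_prop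
  exact (this.measurable.comp hW).aestronglyMeasurable

lemma tendsto_integral_exp_comp_mul_toReal (hW : Measurable W)
    (hac : μ.map W ≪ volume) {F : α → ℝ} (hF : Integrable F μ) :
    Tendsto (fun s : ℝ => ∫ a, Complex.exp (-2 * Complex.I * (W a : ℂ) * (s : ℂ)) *
      ((ENNReal.ofReal (F a)).toReal : ℂ) ∂μ) (cocompact ℝ) (nhds 0) := by
  have : IsFiniteMeasure (μ.withDensity fun a => ENNReal.ofReal (F a)) :=
    isFiniteMeasure_withDensity_ofReal hF.2
  have hν : (μ.withDensity fun a => ENNReal.ofReal (F a)).map W ≪ volume :=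
    ((withDensity_absolutelyContinuous μ _).map hW).trans hac
  refine (tendsto_integral_exp_of_absolutelyContinuous _ hν).congr fun s => ?_
  have hc : Continuous fun x : ℝ => Complex.exp (-2 * Complex.I * (x : ℂ) * (s : ℂ)) := by fun_prop
  rw [integral_map hW.aemeasurable hc.aestronglyMeasurable,
    integral_withDensity_eq_integral_toReal_smul₀ hF.1.aemeasurable.ennreal_ofReal
      (.of_forall fun _ => ENNReal.ofReal_lt_top)]
  refine integral_congr_ae (.of_forall fun v => ?_)
  simp [mul_comm]

lemma tendsto_integral_exp_comp_mul_ofReal (hW : Measurable W)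
    (hac : μ.map W ≪ volume) {F : α → ℝ} (hF : Integrable F μ) :
    Tendsto (fun s : ℝ => ∫ a, Complex.exp (-2 * Complex.I * (W a : ℂ) * (s : ℂ)) * (F a : ℂ) ∂μ)
      (cocompact ℝ) (nhds 0) := by
  have h := (tendsto_integral_exp_comp_mul_toReal hW hac hF).sub
    (tendsto_integral_exp_comp_mul_toReal hW hac hF.neg)
  rw [sub_zero] at h
  refine h.congr fun s => ?_
  have hpos : Integrable (fun a => ((ENNReal.ofReal (F a)).toReal : ℂ)) μ := by
    simpa [ENNReal.toReal_ofReal'] using hF.pos_part.ofReal (𝕜 := ℂ)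
  have hneg : Integrable (fun a => ((ENNReal.ofReal ((-F) a)).toReal : ℂ)) μ := by
    simpa [ENNReal.toReal_ofReal'] using hF.neg_part.ofReal (𝕜 := ℂ)
  rw [← integral_sub (integrable_exp_comp_mul hW hpos s)
    (integrable_exp_comp_mul hW hneg s)]
  refine integral_congr_ae (.of_forall fun a => ?_)
  simp only [← mul_sub, ← Complex.ofReal_sub, ENNReal.toReal_ofReal', Pi.neg_apply]
  congr 2
  exact posPart_sub_negPart (F a)

/-- Riemann–Lebesgue lemma for a phase function whose law is absolutely continuous. -/
lemma tendsto_integral_exp_comp_mul (hW : Measurable W)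
    (hac : μ.map W ≪ volume) {F : α → ℂ} (hF : Integrable F μ) :
    Tendsto (fun s : ℝ => ∫ a, Complex.exp (-2 * Complex.I * (W a : ℂ) * (s : ℂ)) * F a ∂μ)
      (cocompact ℝ) (nhds 0) := by
  have h := (tendsto_integral_exp_comp_mul_ofReal hW hac hF.re).add
    ((tendsto_integral_exp_comp_mul_ofReal hW hac hF.im).mul_const Complex.I)
  rw [zero_mul, add_zero] at h
  refine h.congr fun s => ?_
  have hre : Integrable (fun a => ((F a).re : ℂ)) μ := hF.re.ofReal
  have him : Integrable (fun a => ((F a).im : ℂ)) μ := hF.im.ofReal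
  refine (congrArg _ (integral_mul_const _ _).symm).trans ((integral_add
    (integrable_exp_comp_mul hW hre s)
    ((integrable_exp_comp_mul hW him s).mul_const Complex.I)).symm.trans ?_)
  refine integral_congr_ae (.of_forall fun a => ?_)
  simp only [mul_assoc, ← mul_add]
  congr 1
  exact Complex.re_add_im (F a)

end PhaseFunction

lemma map_norm_absolutelyContinuous {E : Type*} [NormedAddCommGroup E] [NormedSpace ℝ E]
    [MeasurableSpace E] [BorelSpace E] [FiniteDimensional ℝ E] [Nontrivial E]
    (μ : Measure E) [μ.IsAddHaarMeasure] : μ.map (‖·‖) ≪ volume.restrict (Set.Ioi (0 : ℝ)) := by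
  refine Measure.AbsolutelyContinuous.mk fun S hS h0 => ?_
  rw [Measure.map_apply measurable_norm hS]
  have hae : (fun y : ℝ => y ^ (Module.finrank ℝ E - 1) • S.indicator (fun _ => (1 : ℝ)) y)
      =ᵐ[volume.restrict (Set.Ioi 0)] 0 := by
    filter_upwards [measure_eq_zero_iff_ae_notMem.1 h0] with y hy
    simp [hy]
  have hint : Integrable (fun x : E => S.indicator (fun _ => (1 : ℝ)) ‖x‖) μ :=
    (integrable_fun_norm_addHaar μ).2 ((integrable_zero _ _ _).congr hae.symm)
  have hzero : ∫ x : E, S.indicator (fun _ => (1 : ℝ)) ‖x‖ ∂μ = 0 := by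
    rw [integral_fun_norm_addHaar, integral_congr_ae hae]
    simp
  rw [integral_eq_zero_iff_of_nonneg
    (fun x => Set.indicator_nonneg (fun _ _ => zero_le_one) _) hint] at hzero
  rw [measure_eq_zero_iff_ae_notMem]
  filter_upwards [hzero] with x hx hxS
  simp [Set.indicator_of_mem (show ‖x‖ ∈ S from hxS)] at hx

lemma measurable_wfun (m : ℝ) : Measurable (wfun m) := by
  unfold wfun; fun_prop

lemma le_wfun {m : ℝ} (p : EuclideanSpace ℝ (Fin 3)) : m ≤ wfun m p :=
  Real.le_sqrt_of_sq_le (by nlinarith [sq_nonneg ‖p‖])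

lemma map_wfun_absolutelyContinuous (m : ℝ) :
    (volume : Measure (EuclideanSpace ℝ (Fin 3))).map (wfun m) ≪ volume := by
  have hmeas : Measurable fun r : ℝ => Real.sqrt (r ^ 2 + m ^ 2) := by fun_prop
  have hcomp : (volume : Measure (EuclideanSpace ℝ (Fin 3))).map (wfun m) =
      ((volume : Measure (EuclideanSpace ℝ (Fin 3))).map (‖·‖)).map
        fun r : ℝ => Real.sqrt (r ^ 2 + m ^ 2) := by
    rw [Measure.map_map hmeas measurable_norm]
    rfl
  rw [hcomp]
  refine ((map_norm_absolutelyContinuous volume).map hmeas).trans ?_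
  refine Measure.AbsolutelyContinuous.mk fun S hS h0 => ?_
  rw [Measure.map_apply hmeas hS, Measure.restrict_apply (hmeas hS)]
  have hdiff : DifferentiableOn ℝ (fun x : ℝ => Real.sqrt (x ^ 2 - m ^ 2))
      (S ∩ {x | 0 < x ^ 2 - m ^ 2}) := fun x hx =>
    (DifferentiableAt.sqrt (by fun_prop) hx.2.ne').differentiableWithinAt
  refine measure_mono_null ?_
    (addHaar_image_eq_zero_of_differentiableOn_of_addHaar_eq_zero volume hdiff
      (measure_mono_null Set.inter_subset_left h0))
  rintro r ⟨hrS, hr⟩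
  have hr : 0 < r := hr
  have hsq : Real.sqrt (r ^ 2 + m ^ 2) ^ 2 = r ^ 2 + m ^ 2 := Real.sq_sqrt (by positivity)
  refine ⟨Real.sqrt (r ^ 2 + m ^ 2), ⟨hrS, ?_⟩, ?_⟩
  · simp only [Set.mem_ofPred_eq, hsq, add_sub_cancel_right]
    positivity
  · simp only [hsq, add_sub_cancel_right, Real.sqrt_sq hr.le]

/-- The thermal prefactor is bounded for energies bounded below by a positive mass. -/
lemma abs_bplus_sq_div_le {β m x : ℝ} (hβ : 0 < β) (hm : 0 < m) (hx : m ≤ x) :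
    |bplus β x ^ 2 / (4 * x ^ 2)| ≤ bplus β m ^ 2 / (4 * m ^ 2) := by
  have hmx : Real.exp (-β * x) ≤ Real.exp (-β * m) := Real.exp_le_exp.2 (by nlinarith)
  have hm1 : Real.exp (-β * m) < 1 := Real.exp_lt_one_iff.2 (by nlinarith)
  have hb0 : 0 ≤ bplus β x := inv_nonneg.2 (by linarith)
  have hb : bplus β x ≤ bplus β m := inv_anti₀ (by linarith) (by linarith)
  rw [abs_of_nonneg (by positivity)]
  gcongr

/-- The amplitude of the oscillating terms is bounded in the energy. -/
lemma abs_one_sub_exp_div_le {β m x : ℝ} (hβ : 0 < β) (hm : 0 < m) (hx : m ≤ x) :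
    |(1 - Real.exp (-2 * β * x)) / (2 * x)| ≤ 1 / (2 * m) := by
  have hx0 : 0 < x := hm.trans_le hx
  have h1 : Real.exp (-2 * β * x) ≤ 1 := Real.exp_le_one_iff.2 (by nlinarith [mul_pos hβ hx0])
  rw [abs_of_nonneg (div_nonneg (by linarith) (by linarith))]
  gcongr
  linarith [Real.exp_pos (-2 * β * x)]

/-- the large-time limit of the smeared first-order correction `B̂^{[1]}`:
the oscillating terms disappear and only the `β e^{-βw} e^{-2iwδt}` term survives. -/
theorem Bhat_large_time_limit (β m δt : ℝ) (hβ : 0 < β) (hm : 0 < m) (g : ℝ → ℂ)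
    (hgm : Measurable g) (hgb : ∃ C, ∀ x, ‖g x‖ ≤ C)
    (f : EuclideanSpace ℝ (Fin 3) → ℂ) (hf : Integrable f) :
    Tendsto (fun t : ℝ => ∫ p : EuclideanSpace ℝ (Fin 3), Bhat β m δt g t p * f p)
      atTop
      (nhds (((-(2 / (2 * Real.pi) ^ 3) : ℝ) : ℂ) *
        ∫ p : EuclideanSpace ℝ (Fin 3),
          ((bplus β (wfun m p) ^ 2 / (4 * wfun m p ^ 2) *
              (β * Real.exp (-β * wfun m p)) : ℝ) : ℂ) *
            Complex.exp (-2 * Complex.I * (wfun m p : ℂ) * (δt : ℂ)) * f p)) := by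
  obtain ⟨C, hC⟩ := hgb
  have hw := measurable_wfun m
  have hac := map_wfun_absolutelyContinuous m
  set K : EuclideanSpace ℝ (Fin 3) → ℝ := fun p => bplus β (wfun m p) ^ 2 / (4 * wfun m p ^ 2)
    with hK
  set R : EuclideanSpace ℝ (Fin 3) → ℝ :=
    fun p => (1 - Real.exp (-2 * β * wfun m p)) / (2 * wfun m p) with hR
  have hKm : Measurable K := by
    simp only [hK, bplus]; fun_prop
  have hRm : Measurable R := by fun_prop
  have hKf : Integrable (fun p => (K p : ℂ) * f p) :=
    hf.bdd_mul (c := bplus β m ^ 2 / (4 * m ^ 2)) (by fun_prop)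
      (.of_forall fun p => by
        rw [Complex.norm_real]; exact abs_bplus_sq_div_le hβ hm (le_wfun p))
  have hRKf : Integrable (fun p => (R p : ℂ) * (K p * f p)) :=
    hKf.bdd_mul (c := 1 / (2 * m)) (by fun_prop)
      (.of_forall fun p => by
        rw [Complex.norm_real]; exact abs_one_sub_exp_div_le hβ hm (le_wfun p))
  have hpos : Integrable (fun p => g (2 * wfun m p) * (R p * (K p * f p))) :=
    hRKf.bdd_mul (c := C) (hgm.comp (by fun_prop)).aestronglyMeasurable
      (.of_forall fun p => hC _)
  have hneg : Integrable (fun p => g (-(2 * wfun m p)) * (R p * (K p * f p))) :=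
    hRKf.bdd_mul (c := C) (hgm.comp (by fun_prop)).aestronglyMeasurable
      (.of_forall fun p => hC _)
  have hstat : Integrable (fun p => ((K p * (β * Real.exp (-β * wfun m p)) : ℝ) : ℂ) *
      Complex.exp (-2 * Complex.I * (wfun m p : ℂ) * (δt : ℂ)) * f p) := by
    have h := (integrable_exp_comp_mul hw hKf δt).bdd_mul (c := β)
      (f := fun p => ((β * Real.exp (-β * wfun m p) : ℝ) : ℂ)) (by fun_prop)
      (.of_forall fun p => by
        rw [Complex.norm_real, Real.norm_of_nonneg (by positivity)]
        have := hm.trans_le (le_wfun (m := m) p)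
        exact mul_le_of_le_one_right hβ.le (Real.exp_le_one_iff.2 (by nlinarith)))
    refine h.congr (.of_forall fun p => ?_)
    push_cast
    ring
  have hlim := ((((tendsto_integral_exp_comp_mul hw hac hpos).mono_left atTop_le_cocompact).add
    ((tendsto_integral_exp_comp_mul hw hac hneg).comp
      (tendsto_neg_atTop_atBot.mono_right atBot_le_cocompact))).add_const
      (∫ p, ((K p * (β * Real.exp (-β * wfun m p)) : ℝ) : ℂ) *
        Complex.exp (-2 * Complex.I * (wfun m p : ℂ) * (δt : ℂ)) * f p)).const_mul
      ((-(2 / (2 * Real.pi) ^ 3) : ℝ) : ℂ)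
  rw [add_zero, zero_add] at hlim
  refine hlim.congr fun t => ?_
  have hp := integrable_exp_comp_mul hw hpos t
  have hn := integrable_exp_comp_mul hw hneg (-t)
  simp only [Function.comp_apply]
  rw [← integral_add hp hn, ← integral_add (by exact hp.add hn) hstat, ← integral_const_mul]
  refine integral_congr_ae (.of_forall fun p => ?_)
  have hsign : -2 * Complex.I * (wfun m p : ℂ) * ((-t : ℝ) : ℂ) =
      2 * Complex.I * (wfun m p : ℂ) * (t : ℂ) := by
    push_cast; ring
  simp only [hsign, Bhat, hK, hR]
  push_cast
  ring
end

section
/- Let T > 0 and let χ : ℝ → ℝ be continuously differentiable with χ(t) = 0 for t ≤ -T and χ(t) = 1 for t ≥ 0. Let a ∈ ℝ, a ≠ 0, and let ĝ(a) = ∫_ℝ χ'(t) e^{i a t} dt. Then the two (absolutely convergent) double integrals I₁ = ∫_ℝ ∫_ℝ χ'(t₃) χ(t₄) e^{i a (t₄ - t₃)} 𝟙{t₄ < t₃} dt₄ dt₃ and I₂ = ∫_ℝ ∫_ℝ χ'(t₄) χ(t₃) e^{i a (t₄ - t₃)} 𝟙{t₃ < t₄} dt₃ dt₄ satisfy I₁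 - I₂ = ( 1 - |ĝ(a)|² ) / ( i a ). -/
open MeasureTheory

/-- The Fourier transform of `χ'`, truncated to `[L, s]`, at frequency `c`. -/
noncomputable def truncFourier (χ : ℝ → ℝ) (L c s : ℝ) : ℂ :=
  ∫ t in L..s, ((deriv χ t : ℝ) : ℂ) * Complex.exp (Complex.I * (c : ℂ) * (t : ℂ))

section
variable {χ : ℝ → ℝ} {L : ℝ}

lemma continuous_deriv_mul_exp (hχ : ContDiff ℝ 1 χ) (c : ℝ) :
    Continuous fun t : ℝ => ((deriv χ t : ℝ) : ℂ) * Complex.exp (Complex.I * (c : ℂ) * (t : ℂ)) := by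
  have := hχ.continuous_deriv le_rfl
  fun_prop

lemma hasDerivAt_truncFourier (hχ : ContDiff ℝ 1 χ) (L c s : ℝ) :
    HasDerivAt (truncFourier χ L c)
      (((deriv χ s : ℝ) : ℂ) * Complex.exp (Complex.I * (c : ℂ) * (s : ℂ))) s :=
  (continuous_deriv_mul_exp hχ c).integral_hasStrictDerivAt L s |>.hasDerivAt

lemma continuous_truncFourier (hχ : ContDiff ℝ 1 χ) (L c : ℝ) :
    Continuous (truncFourier χ L c) :=
  continuous_iff_continuousAt.2 fun s => (hasDerivAt_truncFourier hχ L c s).continuousAt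

lemma hasDerivAt_ofReal_comp (hχ : ContDiff ℝ 1 χ) (s : ℝ) :
    HasDerivAt (fun t => (χ t : ℂ)) ((deriv χ s : ℝ) : ℂ) s :=
  ((hχ.differentiable one_ne_zero) s).hasDerivAt.ofReal_comp

/-- Integration by parts for `∫ χ(t) e^{ict} dt`. -/
lemma integral_mul_exp_eq (hχ : ContDiff ℝ 1 χ) (hL : χ L = 0) {c : ℝ} (hc : c ≠ 0) (s : ℝ) :
    ∫ t in L..s, (χ t : ℂ) * Complex.exp (Complex.I * (c : ℂ) * (t : ℂ)) =
      ((χ s : ℂ) * Complex.exp (Complex.I * (c : ℂ) * (s : ℂ)) - truncFourier χ L c s) /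
        (Complex.I * (c : ℂ)) := by
  have hne : Complex.I * (c : ℂ) ≠ 0 := mul_ne_zero Complex.I_ne_zero (by exact_mod_cast hc)
  have hcont := hχ.continuous
  have hE : ∀ t : ℝ, HasDerivAt (fun t : ℝ => Complex.exp (Complex.I * (c : ℂ) * (t : ℂ)))
      (Complex.exp (Complex.I * (c : ℂ) * (t : ℂ)) * (Complex.I * (c : ℂ))) t := fun t => by
    simpa using (((hasDerivAt_id t).ofReal_comp).const_mul (Complex.I * (c : ℂ))).cexp
  have hD := continuous_deriv_mul_exp hχ c
  have hC : Continuous fun t : ℝ =>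
      (χ t : ℂ) * (Complex.exp (Complex.I * (c : ℂ) * (t : ℂ)) * (Complex.I * (c : ℂ))) := by
    fun_prop
  have key := intervalIntegral.integral_eq_sub_of_hasDerivAt (a := L) (b := s)
    (fun t _ => (hasDerivAt_ofReal_comp hχ t).mul (hE t))
    ((hD.add hC).intervalIntegrable L s)
  rw [intervalIntegral.integral_add (hD.intervalIntegrable L s) (hC.intervalIntegrable L s)] at key
  simp only [← mul_assoc, intervalIntegral.integral_mul_const] at key
  rw [eq_div_iff hne, ← mul_assoc, truncFourier]
  simp [hL] at key
  linear_combination key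

lemma deriv_eq_zero_of_lt {A : ℝ} (h0 : ∀ t ≤ A, χ t = 0) {t : ℝ} (ht : t < A) :
    deriv χ t = 0 := by
  have : χ =ᶠ[nhds t] fun _ => 0 := by
    filter_upwards [Iio_mem_nhds ht] with u hu using h0 u (le_of_lt hu)
  simp [this.deriv_eq]

lemma deriv_eq_zero_of_gt {B : ℝ} (h1 : ∀ t ≥ B, χ t = 1) {t : ℝ} (ht : B < t) :
    deriv χ t = 0 := by
  have : χ =ᶠ[nhds t] fun _ => 1 := by
    filter_upwards [Ioi_mem_nhds ht] with u hu using h1 u (le_of_lt hu)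
  simp [this.deriv_eq]

/-- The inner time-ordered integral, evaluated by parts. -/
lemma integral_ordered_eq (hχ : ContDiff ℝ 1 χ) {A : ℝ} (h0 : ∀ t ≤ A, χ t = 0) (hLA : L < A)
    {c : ℝ} (hc : c ≠ 0) (s : ℝ) :
    (∫ t : ℝ, if t < s then ((deriv χ s * χ t : ℝ) : ℂ) *
        Complex.exp (Complex.I * (c : ℂ) * ((t - s : ℝ) : ℂ)) else 0) =
      ((deriv χ s : ℝ) : ℂ) * ((χ s : ℂ) -
        Complex.exp (Complex.I * ((-c : ℝ) : ℂ) * (s : ℂ)) * truncFourier χ L c s) /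
        (Complex.I * (c : ℂ)) := by
  rcases lt_or_ge s L with hs | hs
  · simp [deriv_eq_zero_of_lt h0 (hs.trans hLA)]
  have hfun : (fun t : ℝ => if t < s then ((deriv χ s * χ t : ℝ) : ℂ) *
        Complex.exp (Complex.I * (c : ℂ) * ((t - s : ℝ) : ℂ)) else 0) =
      fun t => (((deriv χ s : ℝ) : ℂ) * Complex.exp (Complex.I * ((-c : ℝ) : ℂ) * (s : ℂ))) *
        (Set.Ioo L s).indicator
          (fun t : ℝ => (χ t : ℂ) * Complex.exp (Complex.I * (c : ℂ) * (t : ℂ))) t := by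
    funext t
    by_cases hts : t < s
    · by_cases hLt : L < t
      · rw [if_pos hts, Set.indicator_of_mem (show t ∈ Set.Ioo L s from ⟨hLt, hts⟩)]
        have : Complex.I * (c : ℂ) * ((t - s : ℝ) : ℂ) =
            Complex.I * ((-c : ℝ) : ℂ) * (s : ℂ) + Complex.I * (c : ℂ) * (t : ℂ) := by
          push_cast; ring
        rw [this, Complex.exp_add]
        push_cast
        ring
      · have hz : χ t = 0 := h0 t (by linarith)
        simp [hz, hLt]
    · simp [hts]
  have hexp : Complex.exp (Complex.I * ((-c : ℝ) : ℂ) * (s : ℂ)) *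
      Complex.exp (Complex.I * (c : ℂ) * (s : ℂ)) = 1 := by
    rw [← Complex.exp_add, ← Complex.exp_zero]
    congr 1
    push_cast; ring
  rw [hfun, integral_const_mul, integral_indicator measurableSet_Ioo,
    ← integral_Ioc_eq_integral_Ioo, ← intervalIntegral.integral_of_le hs,
    integral_mul_exp_eq hχ (h0 L hLA.le) hc]
  rw [mul_div_assoc']
  congr 1
  linear_combination ((deriv χ s : ℝ) : ℂ) * (χ s : ℂ) * hexp

lemma integral_eq_intervalIntegral_of_eq_zero {f : ℝ → ℂ} {B : ℝ} (hLB : L ≤ B)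
    (hl : ∀ t ≤ L, f t = 0) (hr : ∀ t > B, f t = 0) :
    ∫ t, f t = ∫ t in L..B, f t := by
  rw [intervalIntegral.integral_of_le hLB, setIntegral_eq_integral_of_forall_compl_eq_zero]
  intro t ht
  rcases le_or_gt t L with h | h
  · exact hl t h
  · exact hr t (not_le.1 fun h' => ht ⟨h, h'⟩)

lemma conj_truncFourier (L B c : ℝ) :
    truncFourier χ L (-c) B = (starRingEnd ℂ) (truncFourier χ L c B) := by
  simp only [truncFourier, intervalIntegral, map_sub, ← integral_conj]
  simp [← Complex.exp_conj]

end

/-- time-integral identity for the switching function: with `χ` a `C¹`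
switching function (`χ = 0` in the far past, `χ = 1` after time `0`), `a ≠ 0`, and
`ĝ(a) = ∫ χ'(t) e^{iat} dt`, the difference of the two ordered double integrals equals
`(1 - |ĝ(a)|²)/(ia)`. -/
theorem switching_double_integral_identity (T : ℝ) (hT : 0 < T) (χ : ℝ → ℝ)
    (hχ : ContDiff ℝ 1 χ) (h0 : ∀ t ≤ -T, χ t = 0) (h1 : ∀ t ≥ (0 : ℝ), χ t = 1)
    (a : ℝ) (ha : a ≠ 0) :
    (∫ t3 : ℝ, ∫ t4 : ℝ,
        if t4 < t3 then
          ((deriv χ t3 * χ t4 : ℝ) : ℂ) *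
            Complex.exp (Complex.I * (a : ℂ) * ((t4 - t3 : ℝ) : ℂ))
        else 0) -
      (∫ t4 : ℝ, ∫ t3 : ℝ,
        if t3 < t4 then
          ((deriv χ t4 * χ t3 : ℝ) : ℂ) *
            Complex.exp (Complex.I * (a : ℂ) * ((t4 - t3 : ℝ) : ℂ))
        else 0) =
      (1 - ((norm (∫ t : ℝ,
          ((deriv χ t : ℝ) : ℂ) * Complex.exp (Complex.I * (a : ℂ) * (t : ℂ))) : ℝ) : ℂ) ^ 2) /
        (Complex.I * (a : ℂ)) := by
  set L : ℝ := -T - 1 with hL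
  have hLT : L < -T := by linarith
  have hLB : L ≤ 1 := by linarith
  have hdl : ∀ t ≤ L, deriv χ t = 0 := fun t ht => deriv_eq_zero_of_lt h0 (ht.trans_lt hLT)
  have hdr : ∀ t > (1 : ℝ), deriv χ t = 0 := fun t ht =>
    deriv_eq_zero_of_gt h1 (zero_lt_one.trans ht)
  have hflip : ∀ t4 t3 : ℝ, Complex.I * (a : ℂ) * ((t4 - t3 : ℝ) : ℂ) =
      Complex.I * ((-a : ℝ) : ℂ) * ((t3 - t4 : ℝ) : ℂ) := fun t4 t3 => by push_cast; ring
  have hI2 : ∀ t4 : ℝ, (∫ t3 : ℝ, if t3 < t4 then ((deriv χ t4 * χ t3 : ℝ) : ℂ) *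
      Complex.exp (Complex.I * (a : ℂ) * ((t4 - t3 : ℝ) : ℂ)) else 0) =
      ((deriv χ t4 : ℝ) : ℂ) * ((χ t4 : ℂ) -
        Complex.exp (Complex.I * (a : ℂ) * (t4 : ℂ)) * truncFourier χ L (-a) t4) /
        (Complex.I * ((-a : ℝ) : ℂ)) := fun t4 => by
    simp only [hflip t4]
    simpa only [neg_neg] using integral_ordered_eq hχ h0 hLT (neg_ne_zero.2 ha) t4
  simp only [integral_ordered_eq hχ h0 hLT ha, hI2, integral_div]
  have hG : ∫ t : ℝ, ((deriv χ t : ℝ) : ℂ) * Complex.exp (Complex.I * (a : ℂ) * (t : ℂ)) =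
      truncFourier χ L a 1 :=
    integral_eq_intervalIntegral_of_eq_zero hLB (fun t ht => by simp [hdl t ht])
      (fun t ht => by simp [hdr t ht])
  rw [hG, integral_eq_intervalIntegral_of_eq_zero hLB (fun t ht => by simp [hdl t ht])
      (fun t ht => by simp [hdr t ht]),
    integral_eq_intervalIntegral_of_eq_zero hLB (fun t ht => by simp [hdl t ht])
      (fun t ht => by simp [hdr t ht])]
  have hcd := hχ.continuous_deriv le_rfl
  have hc := hχ.continuous
  have hGa := continuous_truncFourier hχ L a
  have hGna := continuous_truncFourier hχ L (-a)
  have hc1 : Continuous fun t : ℝ => ((deriv χ t : ℝ) : ℂ) * ((χ t : ℂ) -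
      Complex.exp (Complex.I * ((-a : ℝ) : ℂ) * (t : ℂ)) * truncFourier χ L a t) := by fun_prop
  have hc2 : Continuous fun t : ℝ => ((deriv χ t : ℝ) : ℂ) * ((χ t : ℂ) -
      Complex.exp (Complex.I * (a : ℂ) * (t : ℂ)) * truncFourier χ L (-a) t) := by fun_prop
  have key := intervalIntegral.integral_eq_sub_of_hasDerivAt (a := L) (b := 1)
    (f := fun t => (χ t : ℂ) * (χ t : ℂ) - truncFourier χ L a t * truncFourier χ L (-a) t)
    (f' := fun t => ((deriv χ t : ℝ) : ℂ) * ((χ t : ℂ) -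
        Complex.exp (Complex.I * ((-a : ℝ) : ℂ) * (t : ℂ)) * truncFourier χ L a t) +
      ((deriv χ t : ℝ) : ℂ) * ((χ t : ℂ) -
        Complex.exp (Complex.I * (a : ℂ) * (t : ℂ)) * truncFourier χ L (-a) t))
    (fun t _ => by
      refine (((hasDerivAt_ofReal_comp hχ t).mul (hasDerivAt_ofReal_comp hχ t)).sub
        ((hasDerivAt_truncFourier hχ L a t).mul (hasDerivAt_truncFourier hχ L (-a) t))).congr_deriv ?_
      ring)
    ((hc1.add hc2).intervalIntegrable L 1)
  rw [intervalIntegral.integral_add (hc1.intervalIntegrable L 1) (hc2.intervalIntegrable L 1)]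
    at key
  have hL0 : truncFourier χ L a L = 0 := intervalIntegral.integral_same
  rw [hL0, h1 1 zero_le_one, h0 L hLT.le, conj_truncFourier L 1 a, Complex.mul_conj'] at key
  rw [Complex.ofReal_neg, mul_neg, div_neg, sub_neg_eq_add, ← add_div]
  congr 1
  simpa using key
end

section
/- Let m > 0, c ∈ ℝ, C₀ > 0, and let g : ℝ → ℂ be measurable with |g(x)| ≤ C₀ / (1 + x²) for all x. For β > 0 set b(x) = (1 - e^{-βx})^{-1} and define F(β) = (1/(2π)⁶) c β b(m)² e^{-βm} / (4m²) + (1/(2π)⁶) (π/8) ( e^{-βm} / m² ) b(m) ∫_{2m}^{∞} √(1 - 4m²/M²) · b(M/2)² · [ β b(m) (1 - e^{-βM}) ( |g(M-m)|²/(M-m) + |g(M+m)|²/(M+m) ) + ( e^{-βm} - e^{-βM} ) |g(M-m)|²/(M-m)² + ( e^{-β(M+m)} - 1 ) |g(M+m)|²/(M+m)² - 2 e^{-βM/2} ( |g(m)|²/m² ) ( 1/b(m) ) ] dM. Then for every β > 0 the integral defining F(β) converges absolutely, and F(β) → 0 as β → +∞. -/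
open MeasureTheory Filter

/-- Bose factor `b(x) = (1 - e^{-βx})⁻¹` at inverse temperature `β`. -/
noncomputable def bose (β x : ℝ) : ℝ := (1 - Real.exp (-β * x))⁻¹

/-- The integrand over the two-particle cut `M ∈ (2m, ∞)` appearing in the explicit
value `F̂^{[2]}_∞(0,0)` for the cubic interaction; `g` is the Fourier transform of the
time derivative of the switching function. -/
noncomputable def cubicIntegrand (m β : ℝ) (g : ℝ → ℂ) (M : ℝ) : ℝ :=
  Real.sqrt (1 - 4 * m ^ 2 / M ^ 2) * bose β (M / 2) ^ 2 *
    (β * bose β m * (1 - Real.exp (-β * M)) *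
        (‖g (M - m)‖ ^ 2 / (M - m) +
          ‖g (M + m)‖ ^ 2 / (M + m)) +
      (Real.exp (-β * m) - Real.exp (-β * M)) *
        (‖g (M - m)‖ ^ 2 / (M - m) ^ 2) +
      (Real.exp (-β * (M + m)) - 1) *
        (‖g (M + m)‖ ^ 2 / (M + m) ^ 2) -
      2 * Real.exp (-β * M / 2) * (‖g m‖ ^ 2 / m ^ 2) * (1 / bose β m))

/-- The explicit value `F̂^{[2]}_∞(0,0)`, as a function of the inverse temperature `β`,
of the large-time limit of the second-order discrepancy between the interacting-KMS and
real-time two-point functions for a cubic interaction; `c` is the renormalization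
constant of the fish graph. -/
noncomputable def Fcubic (m c : ℝ) (g : ℝ → ℂ) (β : ℝ) : ℝ :=
  (1 / (2 * Real.pi) ^ 6) * c * β * bose β m ^ 2 * Real.exp (-β * m) / (4 * m ^ 2) +
    (1 / (2 * Real.pi) ^ 6) * (Real.pi / 8) * (Real.exp (-β * m) / m ^ 2) * bose β m *
      ∫ M in Set.Ioi (2 * m), cubicIntegrand m β g M

lemma one_le_bose {β x : ℝ} (h : 0 < β * x) : 1 ≤ bose β x := by
  have h1 : Real.exp (-β * x) < 1 := Real.exp_lt_one_iff.2 (by linarith)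
  have h2 := Real.exp_pos (-β * x)
  exact (one_le_inv₀ (by linarith)).2 (by linarith)

lemma bose_le_bose {β x y : ℝ} (hβ : 0 < β) (hx : 0 < x) (hxy : x ≤ y) :
    bose β y ≤ bose β x := by
  have h1 : Real.exp (-β * x) < 1 := Real.exp_lt_one_iff.2 (by nlinarith)
  have h2 : Real.exp (-β * y) ≤ Real.exp (-β * x) := Real.exp_le_exp.2 (by nlinarith)
  exact inv_anti₀ (by linarith) (by linarith)

lemma tendsto_exp_neg_mul_const_atTop {m : ℝ} (hm : 0 < m) :
    Tendsto (fun β : ℝ => Real.exp (-β * m)) atTop (nhds 0) := by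
  refine Real.tendsto_exp_atBot.comp ?_
  simpa using (tendsto_neg_atTop_atBot (G := ℝ)).atBot_mul_const hm

lemma tendsto_mul_exp_neg_mul_const_atTop {m : ℝ} (hm : 0 < m) :
    Tendsto (fun β : ℝ => β * Real.exp (-β * m)) atTop (nhds 0) := by
  have h := ((Real.tendsto_pow_mul_exp_neg_atTop_nhds_zero 1).comp
    (tendsto_id.atTop_mul_const hm)).div_const m
  rw [zero_div] at h
  refine h.congr fun β => ?_
  simp only [Function.comp_apply, id, pow_one, neg_mul]
  field_simp

lemma tendsto_bose_atTop {m : ℝ} (hm : 0 < m) :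
    Tendsto (fun β : ℝ => bose β m) atTop (nhds 1) := by
  have h := ((tendsto_exp_neg_mul_const_atTop hm).const_sub 1).inv₀ (by norm_num)
  simpa [bose] using h

lemma measurable_cubicIntegrand (m β : ℝ) {g : ℝ → ℂ} (hg : Measurable g) :
    Measurable (cubicIntegrand m β g) := by
  unfold cubicIntegrand bose
  fun_prop

/-- A temperature-independent dominating function for the cubic integrand, up to the
factor `b(m)² (1 + β b(m))`, for all `β ≥ β₀`. -/
noncomputable def cubicBound (m C₀ β₀ : ℝ) (M : ℝ) : ℝ :=
  (2 / m + 2 / m ^ 2) * C₀ ^ 2 * (1 + (M - m) ^ 2)⁻¹ +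
    2 * C₀ ^ 2 / m ^ 2 * Real.exp (-(β₀ / 2) * M)

lemma integrableOn_cubicBound (m C₀ : ℝ) {β₀ : ℝ} (hβ₀ : 0 < β₀) :
    IntegrableOn (cubicBound m C₀ β₀) (Set.Ioi (2 * m)) :=
  ((integrable_inv_one_add_sq.comp_sub_right m).const_mul _).integrableOn.add
    ((integrableOn_exp_mul_Ioi (by linarith) _).const_mul _)

lemma sq_norm_le_of_decay {C₀ : ℝ} {g : ℝ → ℂ}
    (hg : ∀ x : ℝ, ‖g x‖ ≤ C₀ / (1 + x ^ 2)) {x y : ℝ} (hx : 0 ≤ x) (hxy : x ≤ y) :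
    ‖g y‖ ^ 2 ≤ C₀ ^ 2 * (1 + x ^ 2)⁻¹ := by
  have h1 : ‖g y‖ ^ 2 ≤ (C₀ / (1 + y ^ 2)) ^ 2 := by gcongr; exact hg y
  have h2 : ((1 + y ^ 2)⁻¹ : ℝ) ≤ (1 + x ^ 2)⁻¹ := by gcongr
  have h3 : ((1 + y ^ 2)⁻¹ : ℝ) ≤ 1 := inv_le_one_of_one_le₀ (by nlinarith)
  have h4 : (0 : ℝ) ≤ (1 + y ^ 2)⁻¹ := by positivity
  calc ‖g y‖ ^ 2 ≤ C₀ ^ 2 * ((1 + y ^ 2)⁻¹ * (1 + y ^ 2)⁻¹) := by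
        rw [div_eq_mul_inv] at h1; linarith
    _ ≤ C₀ ^ 2 * (1 + x ^ 2)⁻¹ := by gcongr; nlinarith

lemma abs_cubicIntegrand_le {m C₀ β₀ β M : ℝ} (hm : 0 < m) {g : ℝ → ℂ}
    (hg : ∀ x : ℝ, ‖g x‖ ≤ C₀ / (1 + x ^ 2)) (hβ₀ : 0 < β₀) (hβ : β₀ ≤ β) (hM : 2 * m < M) :
    |cubicIntegrand m β g M| ≤
      bose β m ^ 2 * (1 + β * bose β m) * cubicBound m C₀ β₀ M := by
  have hβp : 0 < β := hβ₀.trans_le hβ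
  have hB : 1 ≤ bose β m := one_le_bose (by positivity)
  have hB2 : bose β (M / 2) ≤ bose β m := bose_le_bose hβp hm (by linarith)
  have hB3 : 1 ≤ bose β (M / 2) := one_le_bose (mul_pos hβp (by linarith))
  have hsqrt : Real.sqrt (1 - 4 * m ^ 2 / M ^ 2) ≤ 1 := by
    have : 0 ≤ 4 * m ^ 2 / M ^ 2 := by positivity
    exact Real.sqrt_le_one.2 (by linarith)
  have hK1 := sq_norm_le_of_decay hg (x := M - m) (y := M - m) (by linarith) le_rfl
  have hK2 := sq_norm_le_of_decay hg (x := M - m) (y := M + m) (by linarith) (by linarith)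
  have hgm : ‖g m‖ ^ 2 ≤ C₀ ^ 2 := by
    simpa using sq_norm_le_of_decay hg (x := 0) (y := m) le_rfl hm.le
  set B := bose β m with hBdef
  set K := C₀ ^ 2 * (1 + (M - m) ^ 2)⁻¹ with hK
  have hK0 : 0 ≤ K := by positivity
  have eM : Real.exp (-β * M) ≤ 1 := Real.exp_le_one_iff.2 (by nlinarith)
  have em : Real.exp (-β * m) ≤ 1 := Real.exp_le_one_iff.2 (by nlinarith)
  have eMm : Real.exp (-β * (M + m)) ≤ 1 := Real.exp_le_one_iff.2 (by nlinarith)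
  have emM : Real.exp (-β * M) ≤ Real.exp (-β * m) := Real.exp_le_exp.2 (by nlinarith)
  have eH : Real.exp (-β * M / 2) ≤ Real.exp (-(β₀ / 2) * M) :=
    Real.exp_le_exp.2 (by nlinarith)
  have pM := Real.exp_pos (-β * M)
  have pMm := Real.exp_pos (-β * (M + m))
  have hp1 : ‖g (M - m)‖ ^ 2 / (M - m) ≤ K / m := by gcongr; linarith
  have hp2 : ‖g (M + m)‖ ^ 2 / (M + m) ≤ K / m := by gcongr; linarith
  have hp3 : ‖g (M - m)‖ ^ 2 / (M - m) ^ 2 ≤ K / m ^ 2 := by gcongr; linarith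
  have hp4 : ‖g (M + m)‖ ^ 2 / (M + m) ^ 2 ≤ K / m ^ 2 := by gcongr; linarith
  have hMm : 0 < M - m := by linarith
  have hMm' : 0 < M + m := by linarith
  have t1 : |β * B * (1 - Real.exp (-β * M)) *
      (‖g (M - m)‖ ^ 2 / (M - m) + ‖g (M + m)‖ ^ 2 / (M + m))| ≤
      β * B * 1 * (K / m + K / m) := by
    have : 0 ≤ 1 - Real.exp (-β * M) := by linarith
    rw [abs_of_nonneg (by positivity)]
    gcongr
    linarith
  have t2 : |(Real.exp (-β * m) - Real.exp (-β * M)) * (‖g (M - m)‖ ^ 2 / (M - m) ^ 2)| ≤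
      1 * (K / m ^ 2) := by
    have : 0 ≤ Real.exp (-β * m) - Real.exp (-β * M) := by linarith
    rw [abs_of_nonneg (by positivity)]
    gcongr
    linarith
  have t3 : |(Real.exp (-β * (M + m)) - 1) * (‖g (M + m)‖ ^ 2 / (M + m) ^ 2)| ≤
      1 * (K / m ^ 2) := by
    rw [abs_mul, abs_of_nonneg (a := ‖g (M + m)‖ ^ 2 / (M + m) ^ 2) (by positivity)]
    gcongr
    rw [abs_le]; constructor <;> linarith
  have t4 : |2 * Real.exp (-β * M / 2) * (‖g m‖ ^ 2 / m ^ 2) * (1 / B)| ≤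
      2 * Real.exp (-(β₀ / 2) * M) * (C₀ ^ 2 / m ^ 2) * 1 := by
    rw [abs_of_nonneg (by positivity)]
    gcongr
    exact (div_le_one (by linarith)).2 hB
  rw [cubicIntegrand, abs_mul, abs_mul, abs_of_nonneg (Real.sqrt_nonneg _), abs_pow,
    abs_of_nonneg (a := bose β (M / 2)) (by linarith), mul_assoc (B ^ 2)]
  have hE : 0 ≤ 2 * Real.exp (-(β₀ / 2) * M) * (C₀ ^ 2 / m ^ 2) := by positivity
  have hbound : cubicBound m C₀ β₀ M = (K / m + K / m) + (K / m ^ 2 + K / m ^ 2) +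
      2 * Real.exp (-(β₀ / 2) * M) * (C₀ ^ 2 / m ^ 2) := by
    rw [cubicBound, hK]; ring
  have hβB : 0 ≤ β * B := by positivity
  have hKm : 0 ≤ K / m := by positivity
  have hKm2 : 0 ≤ K / m ^ 2 := by positivity
  have hcoef : Real.sqrt (1 - 4 * m ^ 2 / M ^ 2) * bose β (M / 2) ^ 2 ≤ B ^ 2 := by
    calc _ ≤ 1 * B ^ 2 := by gcongr
      _ = B ^ 2 := one_mul _
  refine mul_le_mul hcoef ?_ (abs_nonneg _) (by positivity)
  refine (abs_sub _ _).trans ((add_le_add ((abs_add_le _ _).trans (add_le_add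
    ((abs_add_le _ _).trans (add_le_add t1 t2)) t3)) t4).trans ?_)
  rw [hbound]
  nlinarith [mul_nonneg hβB hKm2, mul_nonneg hβB hE]

lemma integrableOn_cubicIntegrand {m C₀ β : ℝ} (hm : 0 < m) {g : ℝ → ℂ} (hgm : Measurable g)
    (hg : ∀ x : ℝ, ‖g x‖ ≤ C₀ / (1 + x ^ 2)) (hβ : 0 < β) :
    IntegrableOn (cubicIntegrand m β g) (Set.Ioi (2 * m)) :=
  ((integrableOn_cubicBound m C₀ hβ).const_mul _).mono'
    (measurable_cubicIntegrand m β hgm).aestronglyMeasurable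
    ((ae_restrict_iff' measurableSet_Ioi).2 (.of_forall fun _ hM =>
      abs_cubicIntegrand_le hm hg hβ le_rfl hM))

lemma abs_integral_cubicIntegrand_le {m C₀ β : ℝ} (hm : 0 < m) {g : ℝ → ℂ}
    (hg : ∀ x : ℝ, ‖g x‖ ≤ C₀ / (1 + x ^ 2)) (hβ : 1 ≤ β) :
    |∫ M in Set.Ioi (2 * m), cubicIntegrand m β g M| ≤
      bose β m ^ 2 * (1 + β * bose β m) * ∫ M in Set.Ioi (2 * m), cubicBound m C₀ 1 M := by
  rw [← integral_const_mul, ← Real.norm_eq_abs]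
  exact norm_integral_le_of_norm_le ((integrableOn_cubicBound m C₀ one_pos).const_mul _)
    ((ae_restrict_iff' measurableSet_Ioi).2 (.of_forall fun _ hM =>
      abs_cubicIntegrand_le hm hg one_pos hβ hM))

/-- for every `β > 0` the integral defining `F(β)` converges absolutely,
and `F(β) → 0` in the vacuum limit `β → +∞`. -/
theorem cubic_discrepancy_vanishes_at_zero_temperature (m c C₀ : ℝ) (hm : 0 < m)
    (hC₀ : 0 < C₀) (g : ℝ → ℂ) (hgm : Measurable g)
    (hg : ∀ x : ℝ, ‖g x‖ ≤ C₀ / (1 + x ^ 2)) :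
    (∀ β : ℝ, 0 < β → IntegrableOn (cubicIntegrand m β g) (Set.Ioi (2 * m))) ∧
      Tendsto (Fcubic m c g) atTop (nhds 0) := by
  refine ⟨fun β hβ => integrableOn_cubicIntegrand hm hgm hg hβ, ?_⟩
  have hE := tendsto_exp_neg_mul_const_atTop hm
  have hβE := tendsto_mul_exp_neg_mul_const_atTop hm
  have hb := tendsto_bose_atTop hm
  have hmass : Tendsto (fun β : ℝ => (1 / (2 * Real.pi) ^ 6) * c * β * bose β m ^ 2 *
      Real.exp (-β * m) / (4 * m ^ 2)) atTop (nhds 0) := by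
    have h := (hβE.mul (hb.pow 2)).const_mul ((1 / (2 * Real.pi) ^ 6) * c / (4 * m ^ 2))
    rw [zero_mul, mul_zero] at h
    exact h.congr fun β => by ring
  have hdecay : Tendsto (fun β : ℝ => Real.exp (-β * m) * bose β m *
      ∫ M in Set.Ioi (2 * m), cubicIntegrand m β g M) atTop (nhds 0) := by
    have h := ((hE.mul (hb.pow 3)).add (hβE.mul (hb.pow 4))).mul_const
      (∫ M in Set.Ioi (2 * m), cubicBound m C₀ 1 M)
    rw [zero_mul, zero_mul, add_zero, zero_mul] at h
    refine squeeze_zero_norm' ?_ h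
    filter_upwards [eventually_ge_atTop 1] with β hβ
    have hB : 1 ≤ bose β m := one_le_bose (mul_pos (by linarith) hm)
    have hI := abs_integral_cubicIntegrand_le hm hg hβ
    have h0 : 0 ≤ Real.exp (-β * m) * bose β m := by positivity
    rw [Real.norm_eq_abs, abs_mul, abs_of_nonneg h0]
    refine (mul_le_mul_of_nonneg_left hI h0).trans_eq ?_
    ring
  have h := hmass.add (hdecay.const_mul ((1 / (2 * Real.pi) ^ 6) * (Real.pi / 8) / m ^ 2))
  rw [mul_zero, add_zero] at h
  refine h.congr fun β => ?_
  rw [Fcubic]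
  ring
end
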